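/- Let p be a prime number and d ≥ 2 a natural number not divisible by p. For c ∈ ℂ_p let f_c(z) := z^d + c. Suppose c, c' ∈ ℂ_p satisfy lim_{k→∞} |f_c^k(0)| = ∞, lim_{k→∞} |f_{c'}^k(0)| = ∞, and |c − c'| ≤ |c|^{1/d}. Then there exists a homeomorphism h : J(f_c) → J(f_{c'}) such that h(f_c(z)) = f_{c'}(h(z)) for all z ∈ J(f_c). -/

import Mathlib

open Polynomial

noncomputable section

/-- The projective line over `K`: `K` together with a point at infinity (`none`). -/
def P1 (K : Type*) := Option K

variable {K : Type*}

/-- Inclusion of `K` into the projective line. -/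
def toP1 : K → P1 K := some

/-- The point at infinity of the projective line. -/
def P1.infty : P1 K := none

/-- The extension of a polynomial map to the projective line, sending `∞` to `∞`. -/
def polyMap [CommRing K] (f : K[X]) : P1 K → P1 K :=
  fun z => Option.map (fun w => f.eval w) z

/-- The chordal metric on the projective line over a normed field. -/
def chordal [NormedField K] (x y : P1 K) : ℝ :=
  match x, y with
  | some z, some w => ‖z - w‖ / (max ‖z‖ 1 * max ‖w‖ 1)
  | some z, none => 1 / max ‖z‖ 1
  | none, some w => 1 / max ‖w‖ 1
  | none, none => 0

/-- A subset of the projective line is `ρ`-open if around each of its points it contains a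
ball with respect to the chordal metric. -/
def IsRhoOpen [NormedField K] (U : Set (P1 K)) : Prop :=
  ∀ x ∈ U, ∃ ε > 0, ∀ y, chordal x y < ε → y ∈ U

/-- The topology on the projective line induced by the chordal metric. -/
instance P1.instTopologicalSpace (K : Type*) [NormedField K] : TopologicalSpace (P1 K) where
  IsOpen := IsRhoOpen
  isOpen_univ := fun _ _ => ⟨1, one_pos, fun _ _ => trivial⟩
  isOpen_inter := fun U V hU hV x hx => by
    obtain ⟨ε₁, hε₁, h₁⟩ := hU x hx.1
    obtain ⟨ε₂, hε₂, h₂⟩ := hV x hx.2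
    exact ⟨min ε₁ ε₂, lt_min hε₁ hε₂, fun y hy =>
      ⟨h₁ y (lt_of_lt_of_le hy (min_le_left _ _)), h₂ y (lt_of_lt_of_le hy (min_le_right _ _))⟩⟩
  isOpen_sUnion := fun S hS x hx => by
    obtain ⟨U, hUS, hxU⟩ := hx
    obtain ⟨ε, hε, h⟩ := hS U hUS x hxU
    exact ⟨ε, hε, fun y hy => ⟨U, hUS, h y hy⟩⟩

/-- The Fatou set of a polynomial map: the largest `ρ`-open subset of the projective line on
which the family of iterates is equicontinuous with respect to the chordal metric. -/
def fatou [NormedField K] (f : K[X]) : Set (P1 K) :=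
  {x | ∃ U : Set (P1 K), x ∈ U ∧ IsRhoOpen U ∧
    ∀ y ∈ U, ∀ ε > 0, ∃ δ > 0, ∀ z : P1 K, chordal y z < δ →
      ∀ n : ℕ, chordal ((polyMap f)^[n] y) ((polyMap f)^[n] z) < ε}

/-- The Julia set of a polynomial map: the complement of the Fatou set. -/
def julia [NormedField K] (f : K[X]) : Set (P1 K) :=
  (fatou f)ᶜ

/-- The dynamics of `f` and `g` on their Julia sets are conjugate: there is a homeomorphism
`h : J(f) → J(g)` with `h ∘ f = g ∘ h` on `J(f)`. -/
def JuliaConjugate [NormedField K] (f g : K[X]) : Prop :=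
  ∃ h : (julia f) ≃ₜ (julia g),
    ∀ (z : P1 K) (hz : z ∈ julia f), ∃ hfz : polyMap f z ∈ julia f,
      (h ⟨polyMap f z, hfz⟩ : P1 K) = polyMap g (h ⟨z, hz⟩)

/-- `min {|l|^{1/(l-1)} : 2 ≤ l ≤ d}` where `|l|` is the `p`-adic absolute value of `l`. -/
def muFactor (p : ℕ) [Fact (Nat.Prime p)] (d : ℕ) : ℝ :=
  sInf {x : ℝ | ∃ l : ℕ, 2 ≤ l ∧ l ≤ d ∧ x = ‖(l : ℚ_[p])‖ ^ ((1 : ℝ) / ((l : ℝ) - 1))}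

section Ultrametric

variable {E : Type*} [NormedField E]

/-- Local inverse branches of `z ↦ z ^ d` exist over an algebraically closed field. -/
theorem exists_pow_eq_norm_sub_lt [IsAlgClosed E] {d : ℕ} (hd0 : 0 < d) {r : ℝ} (hr : 0 < r)
    {z y : E} (h : ‖z ^ d - y‖ < r ^ d) : ∃ w, w ^ d = y ∧ ‖z - w‖ < r := by
  have hm : (X ^ d - C y : E[X]).Monic := monic_X_pow_sub_C y hd0.ne'
  have hs : (X ^ d - C y : E[X]).Splits := IsAlgClosed.splits _
  by_contra! hcon
  have hroot : ∀ w ∈ (X ^ d - C y : E[X]).roots, r ≤ ‖z - w‖ := fun w hw => by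
    refine hcon w ?_
    have := (mem_roots hm.ne_zero).1 hw
    simpa [IsRoot, sub_eq_zero] using this
  have hprod := Multiset.prod_map_le_prod_map₀ (fun _ : E => r) (fun w => ‖z - w‖)
    (fun _ _ => hr.le) hroot
  have hcard : Multiset.card (X ^ d - C y : E[X]).roots = d := by
    rw [← hs.natDegree_eq_card_roots, natDegree_X_pow_sub_C]
  have heval : ((X ^ d - C y : E[X]).roots.map fun w => ‖z - w‖).prod = ‖z ^ d - y‖ := by
    have h1 := hs.eval_eq_prod_roots_of_monic hm z
    have h2 := (X ^ d - C y : E[X]).roots.prod_hom' (normHom : E →*₀ ℝ) (fun w => z - w)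
    simp only [eval_sub, eval_pow, eval_X, eval_C] at h1
    rw [h1]
    exact h2
  rw [heval, Multiset.map_const', Multiset.prod_replicate, hcard] at hprod
  exact absurd h hprod.not_gt

variable [IsUltrametricDist E]

/-- The sharp ultrametric inequality for differences. -/
theorem norm_sub_le_max_of_ultrametric (x y : E) : ‖x - y‖ ≤ max ‖x‖ ‖y‖ := by
  simpa [sub_eq_add_neg] using IsUltrametricDist.norm_add_le_max x (-y)

theorem norm_sub_eq_left_of_lt {x y : E} (h : ‖y‖ < ‖x‖) : ‖x - y‖ = ‖x‖ := by
  have := IsUltrametricDist.norm_add_eq_max_of_norm_ne_norm (x := x) (y := -y)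
    (by simpa using h.ne')
  rw [sub_eq_add_neg, this, norm_neg, max_eq_left h.le]

theorem norm_add_eq_left_of_lt {x y : E} (h : ‖y‖ < ‖x‖) : ‖x + y‖ = ‖x‖ := by
  have := IsUltrametricDist.norm_add_eq_max_of_norm_ne_norm h.ne'
  rw [this, max_eq_left h.le]

theorem norm_eq_of_norm_sub_lt {x y : E} (h : ‖x - y‖ < ‖x‖) : ‖y‖ = ‖x‖ := by
  simpa using norm_sub_eq_left_of_lt h

theorem norm_pow_sub_pow_lt {r : ℝ} (hr : 0 < r) {z w : E} (hz : ‖z‖ = r)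
    (hzw : ‖z - w‖ < r) (k : ℕ) : ‖w ^ k - z ^ k‖ < r ^ k := by
  have hw : ‖w‖ = r := (norm_eq_of_norm_sub_lt (hz ▸ hzw)).trans hz
  induction k with
  | zero => simp
  | succ k ih =>
    have e : w ^ (k + 1) - z ^ (k + 1) = w * (w ^ k - z ^ k) - (z - w) * z ^ k := by ring
    rw [e]
    refine (norm_sub_le_max_of_ultrametric _ _).trans_lt (max_lt ?_ ?_)
    · rw [norm_mul, hw, pow_succ']
      exact mul_lt_mul_of_pos_left ih hr
    · rw [norm_mul, norm_pow, hz, pow_succ']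
      exact mul_lt_mul_of_pos_right hzw (pow_pos hr k)

/-- On open balls of radius `r` inside the sphere of radius `r`, the map `z ↦ z ^ d` scales
distances by `r ^ (d - 1)`, provided that `d` is a unit for the norm. -/
theorem norm_pow_sub_pow_eq {d : ℕ} (hd0 : 0 < d) (hd1 : ‖(d : E)‖ = 1) {r : ℝ} (hr : 0 < r)
    {z w : E} (hz : ‖z‖ = r) (hzw : ‖z - w‖ < r) :
    ‖z ^ d - w ^ d‖ = r ^ (d - 1) * ‖z - w‖ := by
  have hne : (Finset.range d).Nonempty := Finset.nonempty_range_iff.2 hd0.ne'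
  have hS : ‖∑ i ∈ Finset.range d, z ^ i * w ^ (d - 1 - i)‖ = r ^ (d - 1) := by
    have hlead : ‖(d : E) * z ^ (d - 1)‖ = r ^ (d - 1) := by
      rw [norm_mul, hd1, one_mul, norm_pow, hz]
    have e : (d : E) * z ^ (d - 1) - ∑ i ∈ Finset.range d, z ^ i * w ^ (d - 1 - i)
        = ∑ i ∈ Finset.range d, -(z ^ i * (w ^ (d - 1 - i) - z ^ (d - 1 - i))) := by
      have : (d : E) * z ^ (d - 1)
          = ∑ i ∈ Finset.range d, z ^ i * z ^ (d - 1 - i) := by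
        rw [Finset.sum_congr rfl (g := fun _ => z ^ (d - 1))]
        · simp
        · intro i hi
          rw [← pow_add]
          congr 1
          have := Finset.mem_range.1 hi
          omega
      rw [this, ← Finset.sum_sub_distrib]
      exact Finset.sum_congr rfl fun i _ => by ring
    rw [← hlead]
    refine norm_eq_of_norm_sub_lt ?_
    rw [hlead, e]
    obtain ⟨i, hi, hle⟩ := IsUltrametricDist.exists_norm_finsetSum_le_of_nonempty hne
      (fun i => -(z ^ i * (w ^ (d - 1 - i) - z ^ (d - 1 - i))))
    refine hle.trans_lt ?_
    have hi' := Finset.mem_range.1 hi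
    have hsplit : r ^ (d - 1) = r ^ i * r ^ (d - 1 - i) := by
      rw [← pow_add]; congr 1; omega
    rw [norm_neg, norm_mul, norm_pow, hz, hsplit]
    exact mul_lt_mul_of_pos_left (norm_pow_sub_pow_lt hr hz hzw _) (pow_pos hr i)
  rw [← (Commute.all z w).geom_sum₂_mul d, norm_mul, hS]

end Ultrametric

section Dynamics

variable {E : Type*} [NormedField E]

/-- The unicritical polynomial map `z ↦ z ^ d + c`. -/
def powAdd (d : ℕ) (c : E) : E → E := fun z => z ^ d + c

theorem powAdd_apply (d : ℕ) (c z : E) : powAdd d c z = z ^ d + c := rfl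

theorem continuous_powAdd (d : ℕ) (c : E) : Continuous (powAdd d c) := by
  unfold powAdd
  fun_prop

/-- The points whose whole forward orbit under `z ↦ z ^ d + c` lies on the sphere of
radius `r`. -/
def sphereOrbits (d : ℕ) (c : E) (r : ℝ) : Set E := {z | ∀ n, ‖(powAdd d c)^[n] z‖ = r}

theorem norm_of_mem_sphereOrbits {d : ℕ} {c z : E} {r : ℝ} (hz : z ∈ sphereOrbits d c r) :
    ‖z‖ = r := hz 0

theorem iterate_mem_sphereOrbits {d : ℕ} {c z : E} {r : ℝ} (hz : z ∈ sphereOrbits d c r)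
    (n : ℕ) : (powAdd d c)^[n] z ∈ sphereOrbits d c r := fun m => by
  rw [← Function.iterate_add_apply]
  exact hz (m + n)

theorem powAdd_mem_sphereOrbits {d : ℕ} {c z : E} {r : ℝ} (hz : z ∈ sphereOrbits d c r) :
    powAdd d c z ∈ sphereOrbits d c r := iterate_mem_sphereOrbits hz 1

theorem iterate_semiconj {d : ℕ} {c c' : E} {r : ℝ} {h : E → E}
    (hh : ∀ z ∈ sphereOrbits d c r, powAdd d c' (h z) = h (powAdd d c z))
    {z : E} (hz : z ∈ sphereOrbits d c r) (n : ℕ) :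
    (powAdd d c')^[n] (h z) = h ((powAdd d c)^[n] z) := by
  induction n with
  | zero => rfl
  | succ n ih =>
    rw [Function.iterate_succ_apply', Function.iterate_succ_apply', ih,
      (hh _ (iterate_mem_sphereOrbits hz n))]

theorem isOpen_compl_sphereOrbits (d : ℕ) (c : E) (r : ℝ) : IsOpen (sphereOrbits d c r)ᶜ := by
  have : sphereOrbits d c r = ⋂ n, {z | ‖(powAdd d c)^[n] z‖ = r} := by
    ext z; simp [sphereOrbits]
  rw [isOpen_compl_iff, this]
  exact isClosed_iInter fun n =>
    isClosed_eq ((continuous_powAdd d c).iterate n).norm continuous_const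

variable [IsUltrametricDist E] {d : ℕ} {c c' : E} {r : ℝ}

theorem one_lt_norm_of_tendsto
    (hc : Filter.Tendsto (fun k => ‖(powAdd d c)^[k] 0‖) Filter.atTop Filter.atTop) :
    1 < ‖c‖ := by
  by_contra! h
  have hb : ∀ k, ‖(powAdd d c)^[k] 0‖ ≤ 1 := fun k => by
    induction k with
    | zero => simp
    | succ k ih =>
      rw [Function.iterate_succ_apply', powAdd_apply]
      refine (IsUltrametricDist.norm_add_le_max _ _).trans (max_le ?_ h)
      rw [norm_pow]
      exact pow_le_one₀ (norm_nonneg _) ih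
  obtain ⟨k, hk⟩ := (hc.eventually_gt_atTop 1).exists
  exact absurd (hb k) hk.not_ge

theorem norm_powAdd_sub_eq (hd0 : 0 < d) (hd1 : ‖(d : E)‖ = 1) (hr : 0 < r)
    {z w : E} (hz : ‖z‖ = r) (hzw : ‖z - w‖ < r) :
    ‖powAdd d c z - powAdd d c w‖ = r ^ (d - 1) * ‖z - w‖ := by
  rw [← norm_pow_sub_pow_eq hd0 hd1 hr hz hzw, powAdd_apply, powAdd_apply,
    add_sub_add_right_eq_sub]

theorem norm_iterate_powAdd_sub_eq (hd0 : 0 < d) (hd1 : ‖(d : E)‖ = 1) (hr : 0 < r)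
    {z w : E} (hz : z ∈ sphereOrbits d c r)
    (h : ∀ n, ‖(powAdd d c)^[n] z - (powAdd d c)^[n] w‖ < r) (n : ℕ) :
    ‖(powAdd d c)^[n] z - (powAdd d c)^[n] w‖ = (r ^ (d - 1)) ^ n * ‖z - w‖ := by
  induction n with
  | zero => simp
  | succ n ih =>
    rw [Function.iterate_succ_apply', Function.iterate_succ_apply',
      norm_powAdd_sub_eq hd0 hd1 hr (hz n) (h n), ih]
    ring

/-- Expansivity: two distinct orbits, one of which stays on the sphere of radius `r`, cannot
stay closer than `r`. -/
theorem eq_of_norm_iterate_powAdd_sub_lt (hd : 2 ≤ d) (hd1 : ‖(d : E)‖ = 1) (hr : 1 < r)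
    {z w : E} (hz : z ∈ sphereOrbits d c r)
    (h : ∀ n, ‖(powAdd d c)^[n] z - (powAdd d c)^[n] w‖ < r) : z = w := by
  by_contra hne
  have hpos : 0 < ‖z - w‖ := norm_pos_iff.2 (sub_ne_zero.2 hne)
  have hL : 1 < r ^ (d - 1) := one_lt_pow₀ hr (by omega)
  obtain ⟨n, hn⟩ := pow_unbounded_of_one_lt (r / ‖z - w‖) hL
  have := h n
  rw [norm_iterate_powAdd_sub_eq (by omega) hd1 (by linarith) hz h] at this
  rw [div_lt_iff₀ hpos] at hn
  linarith

theorem norm_powAdd_of_lt (hr : 0 < r) (hd : 2 ≤ d) (hcr : ‖c‖ = r ^ d) {z : E} (hz : r < ‖z‖) :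
    ‖powAdd d c z‖ = ‖z‖ ^ d := by
  have : ‖c‖ < ‖z ^ d‖ := by
    rw [norm_pow, hcr]
    exact pow_lt_pow_left₀ hz hr.le (by omega)
  rw [powAdd_apply, norm_add_eq_left_of_lt this, norm_pow]

theorem lt_norm_powAdd_of_ne (hr : 1 < r) (hd : 2 ≤ d) (hcr : ‖c‖ = r ^ d) {z : E}
    (hz : ‖z‖ ≠ r) : r < ‖powAdd d c z‖ := by
  rcases lt_or_gt_of_ne hz with h | h
  · have h1 : ‖z ^ d‖ < ‖c‖ := by
      rw [norm_pow, hcr]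
      exact pow_lt_pow_left₀ h (norm_nonneg z) (by omega)
    rw [powAdd_apply, add_comm, norm_add_eq_left_of_lt h1, hcr]
    exact lt_self_pow₀ hr (by omega)
  · rw [norm_powAdd_of_lt (by linarith) hd hcr h]
    exact h.trans (lt_self_pow₀ (hr.trans h) (by omega))

theorem mul_norm_le_norm_powAdd (hr : 1 < r) (hd : 2 ≤ d) (hcr : ‖c‖ = r ^ d) {z : E}
    (hz : r < ‖z‖) : r * ‖z‖ ≤ ‖powAdd d c z‖ := by
  rw [norm_powAdd_of_lt (by linarith) hd hcr hz]
  calc r * ‖z‖ ≤ ‖z‖ * ‖z‖ := by gcongr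
    _ = ‖z‖ ^ 2 := by ring
    _ ≤ ‖z‖ ^ d := pow_le_pow_right₀ (by linarith) hd

theorem pow_mul_norm_le_norm_iterate (hr : 1 < r) (hd : 2 ≤ d) (hcr : ‖c‖ = r ^ d) {z : E}
    (hz : r < ‖z‖) (n : ℕ) :
    r ^ n * ‖z‖ ≤ ‖(powAdd d c)^[n] z‖ ∧ r < ‖(powAdd d c)^[n] z‖ := by
  induction n with
  | zero => simpa using hz
  | succ n ih =>
    rw [Function.iterate_succ_apply']
    have h := mul_norm_le_norm_powAdd hr hd hcr ih.2
    refine ⟨le_trans ?_ h, ?_⟩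
    · rw [pow_succ', mul_assoc]
      exact mul_le_mul_of_nonneg_left ih.1 (by linarith)
    · nlinarith [ih.2]

theorem norm_iterate_eq_of_norm_eq (hr : 1 < r) (hd : 2 ≤ d) (hcr : ‖c‖ = r ^ d) {z w : E}
    (hz : r < ‖z‖) (h : ‖w‖ = ‖z‖) (n : ℕ) :
    ‖(powAdd d c)^[n] w‖ = ‖(powAdd d c)^[n] z‖ := by
  induction n with
  | zero => simpa using h
  | succ n ih =>
    have hn := (pow_mul_norm_le_norm_iterate hr hd hcr hz n).2
    rw [Function.iterate_succ_apply', Function.iterate_succ_apply',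
      norm_powAdd_of_lt (by linarith) hd hcr (ih ▸ hn), norm_powAdd_of_lt (by linarith) hd hcr hn,
      ih]

/-- Every orbit of `z ↦ z ^ d + c` near a given orbit of `z ↦ z ^ d + c'` on the sphere can be
pulled back one step. -/
theorem exists_powAdd_eq_norm_sub_le [IsAlgClosed E] (hd : 2 ≤ d) (hd1 : ‖(d : E)‖ = 1)
    (hr : 1 < r) (hcc : ‖c - c'‖ ≤ r) {z v : E} (hz : ‖z‖ = r)
    (hv : ‖v - powAdd d c z‖ ≤ 1) : ∃ w, powAdd d c' w = v ∧ ‖w - z‖ ≤ 1 := by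
  have hbound : ‖z ^ d - (v - c')‖ ≤ r := by
    have e : z ^ d - (v - c') = -(c - c') - (v - powAdd d c z) := by
      rw [powAdd_apply]; ring
    rw [e]
    refine (norm_sub_le_max_of_ultrametric _ _).trans (max_le ?_ (hv.trans hr.le))
    rwa [norm_neg]
  obtain ⟨w, hw, hzw⟩ := exists_pow_eq_norm_sub_lt (r := r) (by omega : 0 < d) (by linarith)
    (hbound.trans_lt (lt_self_pow₀ hr (by omega)))
  refine ⟨w, by rw [powAdd_apply, hw, sub_add_cancel], ?_⟩
  rw [← hw, norm_pow_sub_pow_eq (by omega) hd1 (by linarith) hz hzw] at hbound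
  have hle : r ≤ r ^ (d - 1) := le_self_pow₀ hr.le (by omega)
  rw [norm_sub_rev]
  by_contra! hcon
  nlinarith

/-- Shadowing: a semiconjugacy between the sphere dynamics of nearby parameters which moves
points by at most `1`. -/
theorem exists_semiconj [IsAlgClosed E] [CompleteSpace E] (hd : 2 ≤ d) (hd1 : ‖(d : E)‖ = 1)
    (hr : 1 < r) (hcc : ‖c - c'‖ ≤ r) :
    ∃ h : E → E, ∀ z ∈ sphereOrbits d c r,
      ‖h z - z‖ ≤ 1 ∧ powAdd d c' (h z) = h (powAdd d c z) := by
  have hbranch : ∀ z v : E, ∃ w, z ∈ sphereOrbits d c r → ‖v - powAdd d c z‖ ≤ 1 →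
      powAdd d c' w = v ∧ ‖w - z‖ ≤ 1 := fun z v => by
    by_cases hz : z ∈ sphereOrbits d c r
    · by_cases hv : ‖v - powAdd d c z‖ ≤ 1
      · obtain ⟨w, hw⟩ := exists_powAdd_eq_norm_sub_le hd hd1 hr hcc
          (norm_of_mem_sphereOrbits hz) hv
        exact ⟨w, fun _ _ => hw⟩
      · exact ⟨0, fun _ h => absurd h hv⟩
    · exact ⟨0, fun h => absurd h hz⟩
  choose B hB using hbranch
  let P : ℕ → E → E := fun n => Nat.rec id (fun _ Q z => B z (Q (powAdd d c z))) n
  have hPs : ∀ n z, P (n + 1) z = B z (P n (powAdd d c z)) := fun _ _ => rfl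
  have hP1 : ∀ n, ∀ z ∈ sphereOrbits d c r, ‖P n z - z‖ ≤ 1 := fun n => by
    induction n with
    | zero => intro z _; simp [P]
    | succ n ih =>
      intro z hz
      rw [hPs]
      exact (hB z _ hz (ih _ (powAdd_mem_sphereOrbits hz))).2
  have hPg : ∀ n, ∀ z ∈ sphereOrbits d c r, powAdd d c' (P (n + 1) z) = P n (powAdd d c z) :=
    fun n z hz => by
      rw [hPs]
      exact (hB z _ hz (hP1 n _ (powAdd_mem_sphereOrbits hz))).1
  have hL : 1 < r ^ (d - 1) := one_lt_pow₀ hr (by omega)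
  have hPd : ∀ n, ∀ z ∈ sphereOrbits d c r,
      dist (P n z) (P (n + 1) z) ≤ 1 * (1 / r ^ (d - 1)) ^ n := fun n => by
    induction n with
    | zero =>
      intro z hz
      simpa [P, dist_eq_norm, norm_sub_rev] using hP1 1 z hz
    | succ n ih =>
      intro z hz
      have h1 := ih _ (powAdd_mem_sphereOrbits hz)
      have hn : ‖P (n + 1) z‖ = r := by
        rw [← norm_of_mem_sphereOrbits hz]
        refine norm_eq_of_norm_sub_lt ?_
        rw [norm_sub_rev, norm_of_mem_sphereOrbits hz]
        exact (hP1 (n + 1) z hz).trans_lt hr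
      have hlt : ‖P (n + 1) z - P (n + 2) z‖ < r := by
        have e : P (n + 1) z - P (n + 2) z = (P (n + 1) z - z) - (P (n + 2) z - z) := by ring
        rw [e]
        exact ((norm_sub_le_max_of_ultrametric _ _).trans
          (max_le (hP1 (n + 1) z hz) (hP1 (n + 2) z hz))).trans_lt hr
      rw [← hPg n z hz, ← hPg (n + 1) z hz, dist_eq_norm,
        norm_powAdd_sub_eq (by omega) hd1 (by linarith) hn hlt] at h1
      rw [dist_eq_norm, pow_succ, one_mul, mul_one_div, le_div_iff₀ (by linarith)]
      linarith
  have hlim : ∀ z, ∃ l, z ∈ sphereOrbits d c r →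
      Filter.Tendsto (fun n => P n z) Filter.atTop (nhds l) := fun z => by
    by_cases hz : z ∈ sphereOrbits d c r
    · obtain ⟨l, hl⟩ := cauchySeq_tendsto_of_complete (cauchySeq_of_le_geometric _ _
        ((div_lt_one (by linarith)).2 hL) (fun n => hPd n z hz))
      exact ⟨l, fun _ => hl⟩
    · exact ⟨0, fun h => absurd h hz⟩
  choose h hh using hlim
  refine ⟨h, fun z hz => ⟨?_, ?_⟩⟩
  · exact le_of_tendsto ((hh z hz).sub_const z).norm (Filter.Eventually.of_forall
      fun n => hP1 n z hz)
  · have h1 := ((continuous_powAdd d c').tendsto (h z)).comp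
      ((hh z hz).comp (Filter.tendsto_add_atTop_nat 1))
    refine tendsto_nhds_unique h1 ((hh _ (powAdd_mem_sphereOrbits hz)).congr fun n => ?_)
    exact (hPg n z hz).symm

theorem semiconj_mem_sphereOrbits (hr : 1 < r) {h : E → E}
    (hh : ∀ z ∈ sphereOrbits d c r, ‖h z - z‖ ≤ 1 ∧ powAdd d c' (h z) = h (powAdd d c z))
    {z : E} (hz : z ∈ sphereOrbits d c r) : h z ∈ sphereOrbits d c' r := fun n => by
  rw [iterate_semiconj (fun z hz => (hh z hz).2) hz, ← hz n]
  refine norm_eq_of_norm_sub_lt ?_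
  rw [norm_sub_rev, hz n]
  exact (hh _ (iterate_mem_sphereOrbits hz n)).1.trans_lt hr

theorem semiconj_leftInverse (hd : 2 ≤ d) (hd1 : ‖(d : E)‖ = 1) (hr : 1 < r) {h k : E → E}
    (hh : ∀ z ∈ sphereOrbits d c r, ‖h z - z‖ ≤ 1 ∧ powAdd d c' (h z) = h (powAdd d c z))
    (hk : ∀ z ∈ sphereOrbits d c' r, ‖k z - z‖ ≤ 1 ∧ powAdd d c (k z) = k (powAdd d c' z))
    {z : E} (hz : z ∈ sphereOrbits d c r) : k (h z) = z := by
  refine (eq_of_norm_iterate_powAdd_sub_lt hd hd1 hr hz fun n => ?_).symm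
  rw [iterate_semiconj (fun z hz => (hk z hz).2) (semiconj_mem_sphereOrbits hr hh hz), iterate_semiconj (fun z hz => (hh z hz).2) hz]
  have hn := iterate_mem_sphereOrbits hz n
  set u := (powAdd d c)^[n] z
  have e : u - k (h u) = -(h u - u) - (k (h u) - h u) := by ring
  rw [e]
  refine ((norm_sub_le_max_of_ultrametric _ _).trans (max_le ?_ ?_)).trans_lt hr
  · rw [norm_neg]
    exact (hh u hn).1
  · exact (hk _ (semiconj_mem_sphereOrbits hr hh hn)).1

theorem norm_semiconj_sub (hd : 2 ≤ d) (hd1 : ‖(d : E)‖ = 1) (hr : 1 < r) {h : E → E}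
    (hh : ∀ z ∈ sphereOrbits d c r, ‖h z - z‖ ≤ 1 ∧ powAdd d c' (h z) = h (powAdd d c z))
    {z w : E} (hz : z ∈ sphereOrbits d c r) (hw : w ∈ sphereOrbits d c r) :
    ‖h z - h w‖ = ‖z - w‖ := by
  rcases eq_or_ne z w with rfl | hne
  · simp
  have hL : 1 < r ^ (d - 1) := one_lt_pow₀ hr (by omega)
  have hpos : 0 < ‖z - w‖ := norm_pos_iff.2 (sub_ne_zero.2 hne)
  obtain ⟨n, hn⟩ := pow_unbounded_of_one_lt (1 / ‖z - w‖) hL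
  rw [div_lt_iff₀ hpos] at hn
  clear hpos hne
  induction n generalizing z w with
  | zero =>
    have e : z - w - (h z - h w) = (h w - w) - (h z - z) := by ring
    refine norm_eq_of_norm_sub_lt ?_
    rw [e]
    refine ((norm_sub_le_max_of_ultrametric _ _).trans
      (max_le (hh w hw).1 (hh z hz).1)).trans_lt (by simpa using hn)
  | succ n ih =>
    rcases lt_or_ge 1 ‖z - w‖ with h1 | h1
    · have e : z - w - (h z - h w) = (h w - w) - (h z - z) := by ring
      refine norm_eq_of_norm_sub_lt ?_
      rw [e]
      exact ((norm_sub_le_max_of_ultrametric _ _).trans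
        (max_le (hh w hw).1 (hh z hz).1)).trans_lt h1
    · have h2 : ‖h z - h w‖ ≤ 1 := by
        have e : h z - h w = (z - w) - ((h w - w) - (h z - z)) := by ring
        rw [e]
        exact (norm_sub_le_max_of_ultrametric _ _).trans (max_le h1
          ((norm_sub_le_max_of_ultrametric _ _).trans (max_le (hh w hw).1 (hh z hz).1)))
      have s1 := norm_powAdd_sub_eq (c := c) (by omega) hd1 (by linarith)
        (norm_of_mem_sphereOrbits hz) (h1.trans_lt hr)
      have s2 := norm_powAdd_sub_eq (c := c') (by omega) hd1 (by linarith)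
        (norm_of_mem_sphereOrbits (semiconj_mem_sphereOrbits hr hh hz)) (h2.trans_lt hr)
      have key := ih (powAdd_mem_sphereOrbits hz) (powAdd_mem_sphereOrbits hw) (by
        rw [s1]
        calc 1 < _ := hn
          _ = _ := by ring)
      rw [← (hh z hz).2, ← (hh w hw).2, s1, s2] at key
      exact mul_left_cancel₀ (by positivity) key

/-- The dynamics on the sphere of two nearby parameters are isometrically conjugate. -/
theorem exists_isometryEquiv_conj [IsAlgClosed E] [CompleteSpace E] (hd : 2 ≤ d)
    (hd1 : ‖(d : E)‖ = 1) (hr : 1 < r) (hcc : ‖c - c'‖ ≤ r) :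
    ∃ φ : sphereOrbits d c r ≃ᵢ sphereOrbits d c' r,
      ∀ z (hz : z ∈ sphereOrbits d c r),
        (φ ⟨powAdd d c z, powAdd_mem_sphereOrbits hz⟩ : E) = powAdd d c' (φ ⟨z, hz⟩) := by
  obtain ⟨h, hh⟩ := exists_semiconj hd hd1 hr hcc
  obtain ⟨k, hk⟩ := exists_semiconj (c := c') (c' := c) hd hd1 hr (norm_sub_rev c c' ▸ hcc)
  refine ⟨⟨⟨fun z => ⟨h z, semiconj_mem_sphereOrbits hr hh z.2⟩,
    fun z => ⟨k z, semiconj_mem_sphereOrbits hr hk z.2⟩,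
    fun z => Subtype.ext (semiconj_leftInverse hd hd1 hr hh hk z.2),
    fun z => Subtype.ext (semiconj_leftInverse hd hd1 hr hk hh z.2)⟩, ?_⟩, ?_⟩
  · refine Isometry.of_dist_eq fun z w => ?_
    rw [Subtype.dist_eq, Subtype.dist_eq, dist_eq_norm, dist_eq_norm]
    exact norm_semiconj_sub hd hd1 hr hh z.2 w.2
  · exact fun z hz => (hh z hz).2.symm

end Dynamics

section ProjectiveLine

variable {E : Type*}

theorem P1.cases (x : P1 E) : x = P1.infty ∨ ∃ z : E, x = toP1 z := by
  cases x with
  | none => exact Or.inl rfl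
  | some z => exact Or.inr ⟨z, rfl⟩

theorem toP1_injective : Function.Injective (toP1 : E → P1 E) := Option.some_injective E

variable [NormedField E]

theorem chordal_toP1 (z w : E) :
    chordal (toP1 z) (toP1 w) = ‖z - w‖ / (max ‖z‖ 1 * max ‖w‖ 1) := rfl

theorem chordal_infty_toP1 (z : E) : chordal P1.infty (toP1 z) = 1 / max ‖z‖ 1 := rfl

theorem chordal_infty_infty : chordal (P1.infty : P1 E) P1.infty = 0 := rfl

theorem one_le_max_mul_max (z w : E) : 1 ≤ max ‖z‖ 1 * max ‖w‖ 1 :=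
  one_le_mul_of_one_le_of_one_le (le_max_right _ _) (le_max_right _ _)

theorem chordal_toP1_le (z w : E) : chordal (toP1 z) (toP1 w) ≤ ‖z - w‖ :=
  div_le_self (norm_nonneg _) (one_le_max_mul_max z w)

theorem polyMap_iterate_toP1 (d : ℕ) (c z : E) (n : ℕ) :
    (polyMap (X ^ d + C c))^[n] (toP1 z) = toP1 ((powAdd d c)^[n] z) := by
  induction n with
  | zero => rfl
  | succ n ih =>
    rw [Function.iterate_succ_apply', Function.iterate_succ_apply', ih]
    simp [polyMap, toP1, powAdd]
    rfl

theorem polyMap_toP1 (d : ℕ) (c z : E) :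
    polyMap (X ^ d + C c) (toP1 z) = toP1 (powAdd d c z) := polyMap_iterate_toP1 d c z 1

theorem polyMap_iterate_infty (f : E[X]) (n : ℕ) :
    (polyMap f)^[n] (P1.infty : P1 E) = P1.infty :=
  Function.iterate_fixed rfl n

variable [IsUltrametricDist E]

theorem norm_le_and_norm_sub_le_of_chordal_lt {z w : E}
    (h : chordal (toP1 z) (toP1 w) < 1 / max ‖z‖ 1) :
    ‖w‖ ≤ max ‖z‖ 1 ∧ ‖z - w‖ ≤ chordal (toP1 z) (toP1 w) * max ‖z‖ 1 ^ 2 := by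
  have hM : 0 < max ‖z‖ 1 := lt_max_of_lt_right one_pos
  have hN : 0 < max ‖w‖ 1 := lt_max_of_lt_right one_pos
  have hw : ‖w‖ ≤ max ‖z‖ 1 := by
    by_contra! hcon
    have h1 : ‖z - w‖ = ‖w‖ := by
      rw [norm_sub_rev]
      exact norm_sub_eq_left_of_lt ((le_max_left _ _).trans_lt hcon)
    have h2 : max ‖w‖ 1 = ‖w‖ := max_eq_left ((le_max_right _ _).trans hcon.le)
    have h3 : 0 < ‖w‖ := hM.trans hcon
    rw [chordal_toP1, h1, h2, lt_div_iff₀ hM] at h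
    field_simp at h
    exact lt_irrefl _ h
  refine ⟨hw, ?_⟩
  have hNM : max ‖w‖ 1 ≤ max ‖z‖ 1 := max_le hw (le_max_right _ _)
  rw [chordal_toP1, div_mul_eq_mul_div, le_div_iff₀ (mul_pos hM hN), sq]
  gcongr

theorem isOpenEmbedding_toP1 : Topology.IsOpenEmbedding (toP1 : E → P1 E) := by
  refine .of_continuous_injective_isOpenMap ?_ toP1_injective ?_
  · refine continuous_def.2 fun U hU => Metric.isOpen_iff.2 fun z hz => ?_
    obtain ⟨ε, hε, h⟩ := hU (toP1 z) hz
    refine ⟨ε, hε, fun w hw => h _ ((chordal_toP1_le z w).trans_lt ?_)⟩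
    rwa [Metric.mem_ball, dist_comm, dist_eq_norm] at hw
  · intro V hV x hx
    obtain ⟨z, hz, rfl⟩ := hx
    obtain ⟨ε, hε, h⟩ := Metric.isOpen_iff.1 hV z hz
    have hM : 0 < max ‖z‖ 1 := lt_max_of_lt_right one_pos
    refine ⟨min (1 / max ‖z‖ 1) (ε / max ‖z‖ 1 ^ 2), by positivity, fun y hy => ?_⟩
    obtain ⟨hy1, hy2⟩ := lt_min_iff.1 hy
    rcases P1.cases y with rfl | ⟨w, rfl⟩
    · exact absurd hy1 (lt_irrefl _)
    · refine ⟨w, h ?_, rfl⟩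
      rw [Metric.mem_ball, dist_comm, dist_eq_norm]
      refine (norm_le_and_norm_sub_le_of_chordal_lt hy1).2.trans_lt ?_
      rwa [lt_div_iff₀ (by positivity)] at hy2

/-- A neighbourhood of `z` in the field contains a chordal ball around `z`. -/
theorem exists_chordal_lt_imp_mem {z : E} {V : Set E} (hV : V ∈ nhds z) :
    ∃ δ > 0, ∀ y, chordal (toP1 z) y < δ → ∃ w ∈ V, y = toP1 w := by
  obtain ⟨W, hWV, hW, hzW⟩ := mem_nhds_iff.1 hV
  obtain ⟨δ, hδ, h⟩ := isOpenEmbedding_toP1.isOpenMap W hW (toP1 z) ⟨z, hzW, rfl⟩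
  refine ⟨δ, hδ, fun y hy => ?_⟩
  obtain ⟨w, hw, rfl⟩ := h y hy
  exact ⟨w, hWV hw, rfl⟩

variable {d : ℕ} {c : E} {r : ℝ}

theorem equicontinuous_at_infty (hr : 1 < r) (hd : 2 ≤ d) (hcr : ‖c‖ = r ^ d) {ε : ℝ}
    (hε : 0 < ε) : ∃ δ > 0, ∀ z : P1 E, chordal P1.infty z < δ →
      ∀ n : ℕ, chordal ((polyMap (X ^ d + C c))^[n] P1.infty)
        ((polyMap (X ^ d + C c))^[n] z) < ε := by
  have hr0 : 0 < r := by linarith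
  refine ⟨min ε (1 / r), by positivity, fun y hy n => ?_⟩
  rw [polyMap_iterate_infty]
  rcases P1.cases y with rfl | ⟨z, rfl⟩
  · rwa [polyMap_iterate_infty, chordal_infty_infty]
  · rw [chordal_infty_toP1] at hy
    obtain ⟨h1, h2⟩ := lt_min_iff.1 hy
    have hz : r < ‖z‖ := by
      have := (one_div_lt_one_div (lt_max_of_lt_right one_pos) hr0).1 h2
      exact (lt_max_iff.1 this).resolve_right (by linarith)
    rw [polyMap_iterate_toP1, chordal_infty_toP1]
    refine lt_of_le_of_lt ?_ h1
    have hn := (pow_mul_norm_le_norm_iterate hr hd hcr hz n).1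
    have : ‖z‖ ≤ ‖(powAdd d c)^[n] z‖ :=
      (le_mul_of_one_le_left (norm_nonneg _) (one_le_pow₀ hr.le)).trans hn
    exact one_div_le_one_div_of_le (lt_max_of_lt_right one_pos) (max_le_max this le_rfl)

theorem equicontinuous_at_escaping (hr : 1 < r) (hd : 2 ≤ d) (hcr : ‖c‖ = r ^ d) {z : E}
    (hz : z ∉ sphereOrbits d c r) {ε : ℝ} (hε : 0 < ε) :
    ∃ δ > 0, ∀ y : P1 E, chordal (toP1 z) y < δ →
      ∀ n : ℕ, chordal ((polyMap (X ^ d + C c))^[n] (toP1 z))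
        ((polyMap (X ^ d + C c))^[n] y) < ε := by
  obtain ⟨N, hN⟩ : ∃ N, r < ‖(powAdd d c)^[N] z‖ := by
    obtain ⟨n, hn⟩ := not_forall.1 hz
    refine ⟨n + 1, ?_⟩
    rw [Function.iterate_succ_apply']
    exact lt_norm_powAdd_of_ne hr hd hcr hn
  obtain ⟨m, hm⟩ := pow_unbounded_of_one_lt (1 / ε) hr
  have hesc := pow_mul_norm_le_norm_iterate hr hd hcr hN
  set M := m + N with hMdef
  have hM : r < ‖(powAdd d c)^[M] z‖ ∧ 1 / ε < ‖(powAdd d c)^[M] z‖ := by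
    rw [hMdef, Function.iterate_add_apply]
    refine ⟨(hesc m).2, hm.trans_le (le_trans ?_ (hesc m).1)⟩
    exact le_mul_of_one_le_right (by positivity) (by linarith)
  have hnear : ∀ᶠ w in nhds z, ∀ n ∈ Finset.range (M + 1),
      ‖(powAdd d c)^[n] z - (powAdd d c)^[n] w‖ < min ε r := by
    refine (Filter.eventually_all_finset _).2 fun n _ => ?_
    have hcont : Continuous fun w => ‖(powAdd d c)^[n] z - (powAdd d c)^[n] w‖ :=
      (continuous_const.sub ((continuous_powAdd d c).iterate n)).norm
    refine hcont.continuousAt.eventually_lt continuousAt_const ?_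
    simp only [sub_self, norm_zero]
    exact lt_min hε (by linarith)
  obtain ⟨δ, hδ, h⟩ := exists_chordal_lt_imp_mem hnear
  refine ⟨δ, hδ, fun y hy n => ?_⟩
  obtain ⟨w, hw, rfl⟩ := h y hy
  rw [polyMap_iterate_toP1, polyMap_iterate_toP1]
  rcases le_or_gt n M with hn | hn
  · exact (chordal_toP1_le _ _).trans_lt
      ((hw n (Finset.mem_range.2 (by omega))).trans_le (min_le_left _ _))
  · obtain ⟨k, rfl⟩ := Nat.exists_eq_add_of_lt hn
    have hwM : ‖(powAdd d c)^[M] w‖ = ‖(powAdd d c)^[M] z‖ :=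
      norm_eq_of_norm_sub_lt (((hw M (by simp)).trans_le (min_le_right _ _)).trans hM.1)
    have e : M + k + 1 = (k + 1) + M := by ring
    rw [e, Function.iterate_add_apply _ (k + 1) M z, Function.iterate_add_apply _ (k + 1) M w]
    have hkw := norm_iterate_eq_of_norm_eq hr hd hcr hM.1 hwM (k + 1)
    have hkz := (pow_mul_norm_le_norm_iterate hr hd hcr hM.1 (k + 1))
    set a := (powAdd d c)^[k + 1] ((powAdd d c)^[M] z)
    set b := (powAdd d c)^[k + 1] ((powAdd d c)^[M] w)
    have ha1 : 1 < ‖a‖ := hr.trans hkz.2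
    have haε : 1 / ε < ‖a‖ := hM.2.trans_le
      ((le_mul_of_one_le_left (norm_nonneg _) (one_le_pow₀ hr.le)).trans hkz.1)
    have hab : ‖a - b‖ ≤ ‖a‖ := by
      simpa [hkw] using norm_sub_le_max_of_ultrametric a b
    rw [chordal_toP1, hkw, max_eq_left ha1.le, div_lt_iff₀ (by positivity)]
    rw [div_lt_iff₀ hε] at haε
    nlinarith

/-- The Julia set of `z ^ d + c` with `|c| = r ^ d > 1` consists of the finite points whose
orbit stays on the sphere of radius `r`. -/
theorem julia_eq_image_sphereOrbits (hr : 1 < r) (hd : 2 ≤ d) (hd1 : ‖(d : E)‖ = 1)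
    (hcr : ‖c‖ = r ^ d) : julia (X ^ d + C c) = toP1 '' sphereOrbits d c r := by
  have hr0 : 0 < r := by linarith
  ext x
  constructor
  · intro hx
    by_contra hcon
    refine hx ⟨(toP1 '' sphereOrbits d c r)ᶜ, hcon, ?_, ?_⟩
    · intro y hy
      rcases P1.cases y with rfl | ⟨z, rfl⟩
      · refine ⟨1 / r, by positivity, fun y hy hmem => ?_⟩
        obtain ⟨z, hz, rfl⟩ := hmem
        rw [chordal_infty_toP1, norm_of_mem_sphereOrbits hz, max_eq_left hr.le] at hy
        exact lt_irrefl _ hy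
      · have hz : z ∈ (sphereOrbits d c r)ᶜ := fun h => hy ⟨z, h, rfl⟩
        obtain ⟨δ, hδ, h⟩ := exists_chordal_lt_imp_mem ((isOpen_compl_sphereOrbits d c r).mem_nhds hz)
        refine ⟨δ, hδ, fun y hy => ?_⟩
        obtain ⟨w, hw, rfl⟩ := h y hy
        exact fun hmem => hw ((toP1_injective.mem_set_image).1 hmem)
    · intro y hy ε hε
      rcases P1.cases y with rfl | ⟨z, rfl⟩
      · exact equicontinuous_at_infty hr hd hcr hε
      · exact equicontinuous_at_escaping hr hd hcr (fun h => hy ⟨z, h, rfl⟩) hε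
  · rintro ⟨z, hz, rfl⟩ ⟨U, hzU, -, hU⟩
    obtain ⟨δ, hδ, h⟩ := hU _ hzU (1 / r) (by positivity)
    have hc1 : 1 < ‖c‖ := hcr ▸ one_lt_pow₀ hr (by omega)
    have hc0 : c ≠ 0 := norm_pos_iff.1 (by linarith)
    obtain ⟨k, hk⟩ := exists_pow_lt_of_lt_one hδ (inv_lt_one_of_one_lt₀ hc1)
    have hne : c⁻¹ ^ k ≠ 0 := pow_ne_zero _ (inv_ne_zero hc0)
    have hclose : chordal (toP1 z) (toP1 (z - c⁻¹ ^ k)) < δ := by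
      refine (chordal_toP1_le _ _).trans_lt ?_
      rwa [sub_sub_cancel, norm_pow, norm_inv]
    have hlt : ∀ n, ‖(powAdd d c)^[n] z - (powAdd d c)^[n] (z - c⁻¹ ^ k)‖ < r := fun n => by
      have hn := h _ hclose n
      rw [polyMap_iterate_toP1, polyMap_iterate_toP1] at hn
      have hmax : max ‖(powAdd d c)^[n] z‖ 1 = r := by rw [hz n, max_eq_left hr.le]
      have h1 := (norm_le_and_norm_sub_le_of_chordal_lt (hmax.symm ▸ hn)).2
      rw [hmax] at h1
      refine h1.trans_lt ?_
      rw [lt_div_iff₀ hr0] at hn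
      nlinarith
    have := eq_of_norm_iterate_powAdd_sub_lt hd hd1 hr hz hlt
    exact hne (sub_eq_self.1 this.symm)

end ProjectiveLine


/-- **Theorem 3.** For `d ≥ 2` not divisible by `p` and parameters `c, c'` with escaping
critical orbits and `|c - c'| ≤ |c|^{1/d}`, the dynamics of `z^d + c` and `z^d + c'` on
their Julia sets are conjugate by a homeomorphism. -/
theorem julia_conjugate_of_escaping_parameters
    {p : ℕ} [Fact (Nat.Prime p)] {K : Type*} [NormedField K] [IsAlgClosed K]
    [CompleteSpace K] [IsUltrametricDist K] [Algebra ℚ_[p] K]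
    (hext : ∀ q : ℚ_[p], ‖algebraMap ℚ_[p] K q‖ = ‖q‖)
    (d : ℕ) (hd : 2 ≤ d) (hpd : ¬ (p ∣ d)) (c c' : K)
    (hc : Filter.Tendsto (fun k => ‖(fun z : K => z ^ d + c)^[k] 0‖)
      Filter.atTop Filter.atTop)
    (hc' : Filter.Tendsto (fun k => ‖(fun z : K => z ^ d + c')^[k] 0‖)
      Filter.atTop Filter.atTop)
    (hclose : ‖c - c'‖ ≤ ‖c‖ ^ ((1 : ℝ) / (d : ℝ))) :
    JuliaConjugate (X ^ d + C c) (X ^ d + C c') := by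
  have hc1 : 1 < ‖c‖ := one_lt_norm_of_tendsto (d := d) hc
  have hd1 : ‖(d : K)‖ = 1 := by
    have h1 := hext (d : ℚ_[p])
    rw [map_natCast] at h1
    rw [h1, Padic.norm_natCast_eq_one_iff]
    exact (Nat.Prime.coprime_iff_not_dvd Fact.out).2 hpd
  set r := ‖c‖ ^ ((1 : ℝ) / (d : ℝ)) with hrdef
  have hr : 1 < r := Real.one_lt_rpow hc1 (by positivity)
  have hcr : ‖c‖ = r ^ d := by
    rw [hrdef, one_div, Real.rpow_inv_natCast_pow (norm_nonneg c) (by omega)]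
  have hcr' : ‖c'‖ = r ^ d := by
    rw [← hcr]
    refine norm_eq_of_norm_sub_lt (hclose.trans_lt ?_)
    rw [hcr]
    exact lt_self_pow₀ hr (by omega)
  obtain ⟨φ, hφ⟩ := exists_isometryEquiv_conj (c := c) (c' := c') hd hd1 hr hclose
  have hJ := julia_eq_image_sphereOrbits hr hd hd1 hcr
  have hJ' := julia_eq_image_sphereOrbits hr hd hd1 hcr'
  have hemb := (isOpenEmbedding_toP1 (E := K)).isEmbedding
  unfold JuliaConjugate
  rw [hJ, hJ']
  refine ⟨((hemb.homeomorphImage _).symm.trans φ.toHomeomorph).trans (hemb.homeomorphImage _),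
    ?_⟩
  rintro _ ⟨z, hz, rfl⟩
  have key : ∀ u (hu : u ∈ sphereOrbits d c r) x (hx : x ∈ toP1 '' sphereOrbits d c r),
      x = toP1 u → ((((hemb.homeomorphImage _).symm.trans φ.toHomeomorph).trans
        (hemb.homeomorphImage _) ⟨x, hx⟩ : toP1 '' sphereOrbits d c' r) : P1 K) =
          toP1 (φ ⟨u, hu⟩ : K) := by
    rintro u hu _ hx rfl
    have : (hemb.homeomorphImage (sphereOrbits d c r)).symm ⟨toP1 u, hx⟩ = ⟨u, hu⟩ := by
      rw [Homeomorph.symm_apply_eq]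
      rfl
    rw [Homeomorph.trans_apply, Homeomorph.trans_apply, this]
    rfl
  have hfz := powAdd_mem_sphereOrbits hz
  have hmap := polyMap_toP1 d c z
  refine ⟨hmap ▸ Set.mem_image_of_mem toP1 hfz, ?_⟩
  refine (key _ hfz _ _ hmap).trans ?_
  refine Eq.trans ?_ (congrArg (polyMap (X ^ d + C c'))
    (key z hz _ (Set.mem_image_of_mem toP1 hz) rfl)).symm
  rw [polyMap_toP1, hφ z hz]
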